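/- Let Δ ≥ 2 be an integer and β ∈ (0, 1/2) be such that (1-β)^{2Δ(1-β)} / (β^{2β} (1-β)^{2(1-β)} (1-2β)^{Δ(1-2β)}) < 1. Then for all sufficiently large n there exists a Δ-regular bipartite graph with parts of size n containing no bi-hole of size ⌈β n⌉. -/

import Mathlib

def BiHole (n k : ℕ) (G : Fin n → Fin n → Prop) : Prop :=
  ∃ X Y : Finset (Fin n), X.card = k ∧ Y.card = k ∧
    ∀ a ∈ X, ∀ b ∈ Y, ¬ G a b

section Collisions

open Finset

variable {ι α : Type*} [Fintype ι] [Fintype α] [DecidableEq α]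

theorem exists_switch (hcard : 2 * Fintype.card ι < Fintype.card α)
    (σ : ι → Equiv.Perm α) (j : ι) (a : α) :
    ∃ a' : α, ∀ l, σ j a' ≠ σ l a ∧ σ j a ≠ σ l a' := by
  let B : Finset α := univ.image (fun l ↦ (σ j).symm (σ l a)) ∪
    univ.image fun l ↦ (σ l).symm (σ j a)
  have hB : #B < #(univ : Finset α) := by
    have h1 := card_union_le (univ.image (fun l ↦ (σ j).symm (σ l a)))
      (univ.image fun l ↦ (σ l).symm (σ j a))
    have h2 := card_image_le (s := univ) (f := fun l ↦ (σ j).symm (σ l a))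
    have h3 := card_image_le (s := univ) (f := fun l ↦ (σ l).symm (σ j a))
    simp only [card_univ] at *
    lia
  obtain ⟨a', -, ha'⟩ := exists_mem_notMem_of_card_lt_card hB
  simp only [B, mem_union, mem_image, mem_univ, true_and, not_or, not_exists] at ha'
  refine ⟨a', fun l ↦ ⟨fun h ↦ ha'.1 l ?_, fun h ↦ ha'.2 l ?_⟩⟩
  · simp [← h]
  · simp [h]

variable [DecidableEq ι]

/-- The triples `(i, j, a)` with `i ≠ j` such that `σ i` and `σ j` agree at `a`. -/
def collisions (σ : ι → Equiv.Perm α) : Finset (ι × ι × α) :=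
  {p | p.1 ≠ p.2.1 ∧ σ p.1 p.2.2 = σ p.2.1 p.2.2}

theorem collisions_update_swap_ssubset (σ : ι → Equiv.Perm α) {i j : ι} {a a' : α}
    (hij : i ≠ j) (ha : σ i a = σ j a)
    (ha' : ∀ l, σ j a' ≠ σ l a ∧ σ j a ≠ σ l a') :
    collisions (Function.update σ j (σ j * Equiv.swap a a')) ⊂ collisions σ := by
  set τ := Function.update σ j (σ j * Equiv.swap a a') with hτ
  have hj (x : α) : τ j x = σ j (Equiv.swap a a' x) := by simp [hτ]
  have hl (l : ι) (h : l ≠ j) : τ l = σ l := by simp [hτ, h]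
  have key (l : ι) (h : l ≠ j) (x : α) (hx : τ j x = τ l x) : σ j x = σ l x := by
    rw [hj, hl l h] at hx
    by_cases h1 : x = a
    · subst h1
      rw [Equiv.swap_apply_left] at hx
      exact absurd hx (ha' l).1
    by_cases h2 : x = a'
    · subst h2
      rw [Equiv.swap_apply_right] at hx
      exact absurd hx (ha' l).2
    rwa [Equiv.swap_apply_of_ne_of_ne h1 h2] at hx
  rw [ssubset_iff_of_subset]
  · refine ⟨(i, j, a), by simp [collisions, hij, ha], ?_⟩
    simp only [collisions, mem_filter, mem_univ, true_and, not_and]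
    intro _ h
    rw [hj, hl i hij, Equiv.swap_apply_left] at h
    exact (ha' i).1 h.symm
  · rintro ⟨p, q, x⟩ h
    simp only [collisions, mem_filter, mem_univ, true_and] at h ⊢
    refine ⟨h.1, ?_⟩
    by_cases hp : p = j
    · subst hp
      exact key q h.1.symm x h.2
    by_cases hq : q = j
    · subst hq
      exact (key p hp x h.2.symm).symm
    rw [← hl p hp, ← hl q hq]
    exact h.2

theorem exists_collisions_eq_empty (hcard : 2 * Fintype.card ι < Fintype.card α)
    (σ : ι → Equiv.Perm α) :
    ∃ τ : ι → Equiv.Perm α, collisions τ = ∅ ∧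
      ∃ D : Finset α, #D ≤ 2 * #(collisions σ) ∧ ∀ a ∉ D, ∀ j, σ j a = τ j a := by
  induction hm : #(collisions σ) using Nat.strong_induction_on generalizing σ with
  | _ m ih =>
  obtain h0 | ⟨⟨i, j, a⟩, h⟩ := (collisions σ).eq_empty_or_nonempty
  · exact ⟨σ, h0, ∅, by simp, by simp⟩
  simp only [collisions, mem_filter, mem_univ, true_and] at h
  obtain ⟨a', ha'⟩ := exists_switch hcard σ j a
  have hlt := card_lt_card (collisions_update_swap_ssubset σ h.1 h.2 ha')
  obtain ⟨τ, hτ, D, hD, hDτ⟩ := ih _ (hm ▸ hlt) _ rfl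
  refine ⟨τ, hτ, insert a (insert a' D), ?_, fun x hx l ↦ ?_⟩
  · have h1 := card_insert_le a (insert a' D)
    have h2 := card_insert_le a' D
    lia
  · simp only [mem_insert, not_or] at hx
    rw [← hDτ x hx.2.2 l]
    by_cases hl : l = j
    · subst hl
      simp [Equiv.swap_apply_of_ne_of_ne hx.1 hx.2.1]
    · simp [hl]

theorem card_agree_mul_card_le {i j : ι} (hij : i ≠ j) (a : α) :
    #{σ : ι → Equiv.Perm α | σ i a = σ j a} * Fintype.card α ≤
      Fintype.card (ι → Equiv.Perm α) := by
  have key (c : α) : #{σ : ι → Equiv.Perm α | σ i a = σ j a} ≤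
      #{σ : ι → Equiv.Perm α | (σ j).symm (σ i a) = c} := by
    refine card_le_card_of_injOn (fun σ ↦ Function.update σ j (σ j * Equiv.swap a c)) ?_ ?_
    · intro σ hσ
      simp only [coe_filter, mem_univ, true_and, Set.mem_ofPred_eq] at hσ ⊢
      rw [Equiv.symm_apply_eq]
      simp [hij, hσ]
    · refine Function.Injective.injOn fun σ τ h ↦ funext fun l ↦ ?_
      have hl := congrFun h l
      by_cases hlj : l = j
      · subst hlj
        simpa using hl
      · simpa [hlj] using hl
  calc _ = ∑ _c : α, #{σ : ι → Equiv.Perm α | σ i a = σ j a} := by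
        rw [sum_const, card_univ, smul_eq_mul, mul_comm]
    _ ≤ ∑ c : α, #{σ : ι → Equiv.Perm α | (σ j).symm (σ i a) = c} :=
        sum_le_sum fun c _ ↦ key c
    _ = _ := by
        rw [← card_univ]
        exact (card_eq_sum_card_fiberwise fun _ _ ↦ mem_univ _).symm

theorem sum_card_collisions_le :
    ∑ σ : ι → Equiv.Perm α, #(collisions σ) ≤
      Fintype.card ι ^ 2 * Fintype.card (ι → Equiv.Perm α) := by
  have h (i j : ι) : ∑ a : α, #{σ : ι → Equiv.Perm α | i ≠ j ∧ σ i a = σ j a} ≤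
      Fintype.card (ι → Equiv.Perm α) := by
    by_cases hij : i = j
    · simp [hij]
    simp only [ne_eq, hij, not_false_eq_true, true_and]
    obtain hα | hα := isEmpty_or_nonempty α
    · simp
    refine Nat.le_of_mul_le_mul_right ?_ (Fintype.card_pos (α := α))
    rw [sum_mul]
    refine (sum_le_card_nsmul _ _ _ fun a _ ↦ card_agree_mul_card_le hij a).trans_eq ?_
    rw [card_univ, smul_eq_mul, mul_comm]
  calc ∑ σ : ι → Equiv.Perm α, #(collisions σ)
      = ∑ p : ι × ι × α, #{σ : ι → Equiv.Perm α | p.1 ≠ p.2.1 ∧ σ p.1 p.2.2 = σ p.2.1 p.2.2} :=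
        sum_card_bipartiteAbove_eq_sum_card_bipartiteBelow _
    _ = ∑ i : ι, ∑ j : ι, ∑ a : α, #{σ : ι → Equiv.Perm α | i ≠ j ∧ σ i a = σ j a} := by
        simp only [Fintype.sum_prod_type]
    _ ≤ ∑ _i : ι, ∑ _j : ι, Fintype.card (ι → Equiv.Perm α) :=
        sum_le_sum fun i _ ↦ sum_le_sum fun j _ ↦ h i j
    _ = _ := by simp only [sum_const, card_univ, smul_eq_mul]; ring

end Collisions

section Avoiding

open Finset

variable {α : Type*} [Fintype α] [DecidableEq α]

theorem card_perm_avoiding_mul_choose_le {k : ℕ} {X Y : Finset α} (hX : #X = k) (hY : #Y = k) :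
    #{σ : Equiv.Perm α | ∀ a ∈ X, σ a ∉ Y} * (Fintype.card α).choose k ≤
      Fintype.card (Equiv.Perm α) * (Fintype.card α - k).choose k := by
  have key (Z : Finset α) (hZ : Z ∈ powersetCard k univ) :
      #{σ : Equiv.Perm α | ∀ a ∈ X, σ a ∉ Y} ≤ #{σ : Equiv.Perm α | ∀ a ∈ X, σ a ∉ Z} := by
    obtain ⟨-, hZ⟩ := mem_powersetCard.mp hZ
    let π : Equiv.Perm α := (equivOfCardEq (hY.trans hZ.symm)).extendSubtype
    refine card_le_card_of_injOn (fun σ ↦ π * σ) ?_ (mul_right_injective π).injOn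
    intro σ hσ
    simp only [coe_filter, mem_univ, true_and, Set.mem_ofPred_eq, Equiv.Perm.mul_apply] at hσ ⊢
    exact fun a ha ↦ Equiv.extendSubtype_not_mem _ _ (hσ a ha)
  have hcard (σ : Equiv.Perm α) :
      #{Z ∈ powersetCard k univ | ∀ a ∈ X, σ a ∉ Z} = (Fintype.card α - k).choose k := by
    have : ({Z ∈ powersetCard k univ | ∀ a ∈ X, σ a ∉ Z} : Finset (Finset α)) =
        powersetCard k (X.map σ.toEmbedding)ᶜ := by
      ext Z
      simp only [mem_filter, mem_powersetCard (t := (X.map _)ᶜ), mem_powersetCard_univ, subset_iff,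
        mem_compl, mem_map_equiv]
      constructor
      · rintro ⟨h1, h2⟩
        exact ⟨fun x hx hx' ↦ h2 _ hx' (by simpa using hx), h1⟩
      · rintro ⟨h1, h2⟩
        exact ⟨h2, fun a ha ha' ↦ h1 ha' (by simpa using ha)⟩
    rw [this, card_powersetCard, card_compl, card_map, hX]
  calc _ = ∑ _Z ∈ powersetCard k (univ : Finset α),
          #{σ : Equiv.Perm α | ∀ a ∈ X, σ a ∉ Y} := by
        rw [sum_const, card_powersetCard, card_univ, smul_eq_mul, mul_comm]
    _ ≤ ∑ Z ∈ powersetCard k univ, #{σ : Equiv.Perm α | ∀ a ∈ X, σ a ∉ Z} := sum_le_sum key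
    _ = ∑ σ : Equiv.Perm α, #{Z ∈ powersetCard k univ | ∀ a ∈ X, σ a ∉ Z} :=
        (sum_card_bipartiteAbove_eq_sum_card_bipartiteBelow _).symm
    _ = _ := by simp [hcard, card_univ]

/-- If the binomial inequality holds, a first moment argument yields a tuple of permutations with
few collisions and without `k × k` holes. -/
theorem exists_few_collisions_no_hole {ι : Type*} [Fintype ι] [DecidableEq ι] {k : ℕ}
    (h : 2 * (Fintype.card α).choose k ^ 2 * (Fintype.card α - k).choose k ^ Fintype.card ι <
      (Fintype.card α).choose k ^ Fintype.card ι) :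
    ∃ σ : ι → Equiv.Perm α, #(collisions σ) ≤ 2 * Fintype.card ι ^ 2 ∧
      ∀ X Y : Finset α, #X = k → #Y = k → ∃ j, ∃ a ∈ X, σ j a ∈ Y := by
  set c := Fintype.card ι
  set C := (Fintype.card α).choose k
  set P := Fintype.card (Equiv.Perm α)
  have hP : 0 < P := Fintype.card_pos
  have hT : Fintype.card (ι → Equiv.Perm α) = P ^ c := by simp [P, c]
  let S : Finset (Finset α × Finset α) := powersetCard k univ ×ˢ powersetCard k univ
  let holes (σ : ι → Equiv.Perm α) : ℕ := #{p ∈ S | ∀ j, ∀ a ∈ p.1, σ j a ∉ p.2}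
  have hp (p) (hp : p ∈ S) :
      #{σ : ι → Equiv.Perm α | ∀ j, ∀ a ∈ p.1, σ j a ∉ p.2} * C ^ c ≤
        P ^ c * (Fintype.card α - k).choose k ^ c := by
    simp only [S, mem_product, mem_powersetCard, subset_univ, true_and] at hp
    have : ({σ : ι → Equiv.Perm α | ∀ j, ∀ a ∈ p.1, σ j a ∉ p.2} : Finset _) =
        Fintype.piFinset fun _ ↦ {σ : Equiv.Perm α | ∀ a ∈ p.1, σ a ∉ p.2} := by
      ext σ; simp
    rw [this, Fintype.card_piFinset, prod_const, card_univ, ← mul_pow, ← mul_pow]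
    exact Nat.pow_le_pow_left (card_perm_avoiding_mul_choose_le hp.1 hp.2) _
  have hholes : 2 * ∑ σ, holes σ < P ^ c := by
    have h1 : ∑ σ, holes σ = ∑ p ∈ S, #{σ : ι → Equiv.Perm α | ∀ j, ∀ a ∈ p.1, σ j a ∉ p.2} :=
      sum_card_bipartiteAbove_eq_sum_card_bipartiteBelow _
    have h2 : (∑ σ, holes σ) * C ^ c ≤ C ^ 2 * (P ^ c * (Fintype.card α - k).choose k ^ c) := by
      rw [h1, sum_mul]
      refine (sum_le_card_nsmul _ _ _ hp).trans_eq ?_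
      simp [S, card_product, C, sq]
    refine lt_of_mul_lt_mul_right (a := C ^ c) ?_ (Nat.zero_le _)
    calc 2 * (∑ σ, holes σ) * C ^ c
        ≤ 2 * (C ^ 2 * (P ^ c * (Fintype.card α - k).choose k ^ c)) := by
          rw [mul_assoc]; exact Nat.mul_le_mul_left _ h2
      _ = P ^ c * (2 * C ^ 2 * (Fintype.card α - k).choose k ^ c) := by ring
      _ < P ^ c * C ^ c := Nat.mul_lt_mul_of_pos_left h (by positivity)
  by_contra! hcon
  have hlow (σ : ι → Equiv.Perm α) :
      2 * c ^ 2 + 1 ≤ #(collisions σ) + (2 * c ^ 2 + 1) * holes σ := by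
    by_cases hσ : #(collisions σ) ≤ 2 * c ^ 2
    · obtain ⟨X, Y, hX, hY, hXY⟩ := hcon σ hσ
      have : 0 < holes σ := card_pos.mpr ⟨(X, Y), by simpa [S, hX, hY] using hXY⟩
      nlinarith
    · lia
  have hsum := sum_le_sum fun σ (_ : σ ∈ univ) ↦ hlow σ
  rw [sum_const, card_univ, hT, smul_eq_mul, sum_add_distrib, ← mul_sum] at hsum
  have hcoll := sum_card_collisions_le (ι := ι) (α := α)
  rw [hT] at hcoll
  have := Nat.mul_lt_mul_of_pos_left hholes (Nat.succ_pos (2 * c ^ 2))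
  simp only [c] at *
  nlinarith

end Avoiding

/-- A tuple of permutations with few collisions and no holes can be repaired to a regular bipartite
graph with no slightly larger holes. -/
theorem exists_regular_no_biHole {n Δ k m : ℕ} (hn : 2 * Δ < n) (hm : k + 4 * Δ ^ 2 ≤ m)
    (h : 2 * n.choose k ^ 2 * (n - k).choose k ^ Δ < n.choose k ^ Δ) :
    ∃ G : Fin n → Fin n → Prop,
      (∀ a : Fin n, Nat.card {b : Fin n // G a b} = Δ) ∧
      (∀ b : Fin n, Nat.card {a : Fin n // G a b} = Δ) ∧ ¬ BiHole n m G := by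
  obtain ⟨σ, hσ, hhole⟩ := exists_few_collisions_no_hole (ι := Fin Δ) (α := Fin n) (k := k)
    (by simpa using h)
  obtain ⟨τ, hτ, D, hD, hDτ⟩ := exists_collisions_eq_empty (by simpa using hn) σ
  have hinj (a : Fin n) {i j : Fin Δ} (hij : τ i a = τ j a) : i = j := by
    by_contra hne
    have : (i, j, a) ∈ collisions τ := by simp [collisions, hne, hij]
    simp [hτ] at this
  refine ⟨fun a b ↦ ∃ j, τ j a = b, fun a ↦ ?_, fun b ↦ ?_, ?_⟩
  · have : Function.Injective fun j ↦ τ j a := fun i j hij ↦ hinj a hij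
    exact (Nat.card_range_of_injective this).trans (Nat.card_fin Δ)
  · have : Function.Injective fun j ↦ (τ j).symm b := fun i j hij ↦ by
      simp only at hij
      refine hinj ((τ i).symm b) ?_
      rw [Equiv.apply_symm_apply, hij, Equiv.apply_symm_apply]
    have hcard := Nat.card_range_of_injective this
    have hrange : Set.range (fun j ↦ (τ j).symm b) = {a | ∃ j, τ j a = b} := by
      ext a
      simp [Equiv.symm_apply_eq, eq_comm (a := b)]
    rw [Nat.card_fin, hrange] at hcard
    exact hcard
  · rintro ⟨X, Y, hX, hY, hXY⟩
    rw [Fintype.card_fin] at hσ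
    obtain ⟨X', hX', hX'k⟩ := Finset.exists_subset_card_eq (s := X \ D) (n := k) (by
      have := Finset.le_card_sdiff D X
      lia)
    obtain ⟨Y', hY', hY'k⟩ := Finset.exists_subset_card_eq (s := Y) (n := k) (by lia)
    obtain ⟨j, a, ha, haY⟩ := hhole X' Y' hX'k hY'k
    obtain ⟨haX, haD⟩ := Finset.mem_sdiff.mp (hX' ha)
    exact hXY a haX _ (hY' haY) ⟨j, (hDτ a haD j).symm⟩

section Asymptotics

open Filter Topology Real
open scoped Nat

theorem tendsto_log_factorial_sub_div :
    Tendsto (fun m : ℕ ↦ (log (m ! : ℝ) - (m * log m - m)) / m) atTop (𝓝 0) := by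
  have h1 : Tendsto (fun m : ℕ ↦ log (Stirling.stirlingSeq m) / m) atTop (𝓝 0) :=
    (Stirling.tendsto_stirlingSeq_sqrt_pi.log (by positivity)).div_atTop
      tendsto_natCast_atTop_atTop
  have h2 : Tendsto (fun m : ℕ ↦ log (2 * m) / (2 * m)) atTop (𝓝 0) :=
    isLittleO_log_id_atTop.tendsto_div_nhds_zero.comp
      (tendsto_natCast_atTop_atTop.const_mul_atTop two_pos)
  have h3 := h1.add h2
  rw [add_zero] at h3
  refine h3.congr' ?_
  filter_upwards [eventually_ne_atTop 0] with m hm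
  have hm' : (m : ℝ) ≠ 0 := by exact_mod_cast hm
  rw [Stirling.log_stirlingSeq_formula, log_div hm' (exp_ne_zero 1), log_exp]
  field_simp
  ring

/-- Coarse Stirling formula for `m n` factorial, normalized by `n`, when `m n ∼ x n`. -/
theorem tendsto_log_factorial_comp {m : ℕ → ℕ} {x : ℝ} (hx : 0 < x)
    (hm : Tendsto (fun n ↦ (m n : ℝ) / n) atTop (𝓝 x)) :
    Tendsto (fun n : ℕ ↦ (log ((m n)! : ℝ) - (m n * log n - m n)) / n) atTop
      (𝓝 (x * log x)) := by
  have hm_top : Tendsto m atTop atTop := by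
    rw [← tendsto_natCast_atTop_iff (R := ℝ)]
    refine (hm.pos_mul_atTop hx tendsto_natCast_atTop_atTop).congr' ?_
    filter_upwards [eventually_ne_atTop 0] with n hn
    field_simp
  have h := (hm.mul (tendsto_log_factorial_sub_div.comp hm_top)).add
    (hm.mul (hm.log hx.ne'))
  rw [mul_zero, zero_add] at h
  refine h.congr' ?_
  filter_upwards [eventually_ne_atTop 0, hm_top.eventually_ne_atTop 0] with n hn hmn
  have hn' : (n : ℝ) ≠ 0 := by exact_mod_cast hn
  have hmn' : (m n : ℝ) ≠ 0 := by exact_mod_cast hmn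
  rw [Function.comp_apply, log_div hmn' hn']
  field_simp
  ring

theorem log_choose {n k : ℕ} (h : k ≤ n) :
    log (n.choose k : ℝ) = log (n ! : ℝ) - log (k ! : ℝ) - log ((n - k)! : ℝ) := by
  rw [Nat.cast_choose ℝ h, log_div (by positivity) (by positivity),
    log_mul (by positivity) (by positivity)]
  ring

theorem eventually_choose_lt {Δ : ℕ} {β : ℝ} (hβ₀ : 0 < β) (hβ₁ : β < 1 / 2) {k : ℕ → ℕ}
    (hk : Tendsto (fun n ↦ (k n : ℝ) / n) atTop (𝓝 β))
    (hineq : 2 * Δ * ((1 - β) * log (1 - β)) - (2 * (β * log β) + 2 * ((1 - β) * log (1 - β))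
      + Δ * ((1 - 2 * β) * log (1 - 2 * β))) < 0) :
    ∀ᶠ n in atTop,
      2 * n.choose (k n) ^ 2 * (n - k n).choose (k n) ^ Δ < n.choose (k n) ^ Δ := by
  have hlt : ∀ᶠ n in atTop, 2 * k n < n := by
    filter_upwards [hk.eventually_lt_const hβ₁, eventually_gt_atTop 0] with n hn hn0
    rw [div_lt_iff₀ (by exact_mod_cast hn0)] at hn
    have : (2 * k n : ℝ) < n := by linarith
    exact_mod_cast this
  have hone : Tendsto (fun n : ℕ ↦ (n : ℝ) / n) atTop (𝓝 1) := by
    refine tendsto_const_nhds.congr' ?_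
    filter_upwards [eventually_ne_atTop 0] with n hn
    field_simp
  have hk₁ : Tendsto (fun n ↦ ((n - k n : ℕ) : ℝ) / n) atTop (𝓝 (1 - β)) := by
    refine (hone.sub hk).congr' ?_
    filter_upwards [hlt] with n hn
    rw [Nat.cast_sub (by lia), sub_div]
  have hk₂ : Tendsto (fun n ↦ ((n - k n - k n : ℕ) : ℝ) / n) atTop (𝓝 (1 - 2 * β)) := by
    rw [show 1 - 2 * β = 1 - β - β by ring]
    refine (hk₁.sub hk).congr' ?_
    filter_upwards [hlt] with n hn
    rw [Nat.cast_sub (show k n ≤ n - k n by lia), sub_div]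
  have L := tendsto_log_factorial_comp (m := id) one_pos hone
  have L₀ := tendsto_log_factorial_comp hβ₀ hk
  have L₁ := tendsto_log_factorial_comp (by linarith) hk₁
  have L₂ := tendsto_log_factorial_comp (by linarith) hk₂
  have hlog2 : Tendsto (fun n : ℕ ↦ log 2 / (n : ℝ)) atTop (𝓝 0) :=
    tendsto_const_nhds.div_atTop tendsto_natCast_atTop_atTop
  have hlim := (hlog2.add (((L.sub L₀).sub L₁).const_mul 2)).add
    (((L₁.const_mul 2).sub (L₂.add L)).const_mul (Δ : ℝ))
  have hneg := hlim.eventually_lt_const (u := 0) (by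
    rw [log_one]
    linarith)
  filter_upwards [hneg, hlt, eventually_gt_atTop 0] with n hn hkn hn0
  have hn0' : (0 : ℝ) < n := by exact_mod_cast hn0
  have c₁ : (0 : ℝ) < n.choose (k n) := by exact_mod_cast Nat.choose_pos (by lia)
  have c₂ : (0 : ℝ) < (n - k n).choose (k n) := by exact_mod_cast Nat.choose_pos (by lia)
  have key : log (2 * (n.choose (k n) : ℝ) ^ 2 * ((n - k n).choose (k n) : ℝ) ^ Δ) <
      log ((n.choose (k n) : ℝ) ^ Δ) := by
    rw [log_mul (by positivity) (by positivity), log_mul (by positivity) (by positivity),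
      log_pow, log_pow, log_pow, log_choose (by lia), log_choose (by lia)]
    have h2 : ((n - k n - k n : ℕ) : ℝ) = n - k n - k n := by
      rw [Nat.cast_sub (by lia), Nat.cast_sub (by lia)]
    have h1 : ((n - k n : ℕ) : ℝ) = n - k n := Nat.cast_sub (by lia)
    rw [h1, h2] at hn
    simp only [id_eq] at hn
    have := mul_neg_of_neg_of_pos hn hn0'
    field_simp at this
    push_cast
    linarith
  exact_mod_cast (log_lt_log_iff (by positivity) (by positivity)).mp key

theorem exponent_neg {Δ β : ℝ} (hβ₀ : 0 < β) (hβ₁ : β < 1 / 2)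
    (hineq : (1 - β) ^ (2 * Δ * (1 - β)) /
      (β ^ (2 * β) * (1 - β) ^ (2 * (1 - β)) * (1 - 2 * β) ^ (Δ * (1 - 2 * β))) < 1) :
    2 * Δ * ((1 - β) * log (1 - β)) - (2 * (β * log β) + 2 * ((1 - β) * log (1 - β))
      + Δ * ((1 - 2 * β) * log (1 - 2 * β))) < 0 := by
  have h1 : 0 < 1 - β := by linarith
  have h2 : 0 < 1 - 2 * β := by linarith
  have h := log_neg (by positivity) hineq
  rw [log_div (by positivity) (by positivity), log_mul (by positivity) (by positivity),
    log_mul (by positivity) (by positivity), log_rpow h1, log_rpow hβ₀, log_rpow h1,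
    log_rpow h2] at h
  linarith

theorem tendsto_ceil_mul_sub_div {β : ℝ} (hβ : 0 ≤ β) (c : ℕ) :
    Tendsto (fun n : ℕ ↦ ((⌈β * n⌉₊ - c : ℕ) : ℝ) / n) atTop (𝓝 β) := by
  have h1 : Tendsto (fun n : ℕ ↦ (⌈β * n⌉₊ : ℝ) / n) atTop (𝓝 β) :=
    (tendsto_nat_ceil_mul_div_atTop hβ).comp tendsto_natCast_atTop_atTop
  have h2 : Tendsto (fun n : ℕ ↦ (⌈β * n⌉₊ : ℝ) / n - c / n) atTop (𝓝 β) := by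
    simpa using h1.sub (tendsto_const_nhds.div_atTop tendsto_natCast_atTop_atTop)
  refine tendsto_of_tendsto_of_tendsto_of_le_of_le h2 h1 (fun n ↦ ?_) fun n ↦ ?_
  · dsimp only
    rw [← sub_div]
    gcongr
    rw [sub_le_iff_le_add]
    exact_mod_cast le_tsub_add
  · dsimp only
    gcongr
    exact tsub_le_self

theorem tendsto_ceil_mul_atTop {β : ℝ} (hβ : 0 < β) :
    Tendsto (fun n : ℕ ↦ ⌈β * n⌉₊) atTop atTop :=
  tendsto_nat_ceil_atTop.comp (tendsto_natCast_atTop_atTop.const_mul_atTop hβ)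

end Asymptotics

/-- if `Δ ≥ 2` and `β ∈ (0, 1/2)` satisfies the displayed
inequality, then for all large `n` there is a `Δ`-regular `n × n` bipartite
graph with no bi-hole of size `⌈β n⌉`. -/
theorem regular_graph_no_bihole (Δ : ℕ) (hΔ : 2 ≤ Δ) (β : ℝ)
    (hβ : β ∈ Set.Ioo (0 : ℝ) (1 / 2))
    (hineq : (1 - β) ^ (2 * (Δ : ℝ) * (1 - β)) /
      (β ^ (2 * β) * (1 - β) ^ (2 * (1 - β)) *
        (1 - 2 * β) ^ ((Δ : ℝ) * (1 - 2 * β))) < 1) :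
    ∃ N : ℕ, ∀ n : ℕ, N ≤ n →
      ∃ G : Fin n → Fin n → Prop,
        (∀ a : Fin n, Nat.card {b : Fin n // G a b} = Δ) ∧
        (∀ b : Fin n, Nat.card {a : Fin n // G a b} = Δ) ∧
        ¬ BiHole n ⌈β * n⌉₊ G := by
  have hlim := tendsto_ceil_mul_sub_div hβ.1.le (4 * Δ ^ 2)
  obtain ⟨N, hN⟩ := Filter.eventually_atTop.mp <|
    (eventually_choose_lt hβ.1 hβ.2 hlim (exponent_neg hβ.1 hβ.2 hineq)).and <|
    ((tendsto_ceil_mul_atTop hβ.1).eventually_ge_atTop (4 * Δ ^ 2)).and <|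
    Filter.eventually_gt_atTop (2 * Δ)
  refine ⟨N, fun n hn ↦ ?_⟩
  obtain ⟨h, hk, hn⟩ := hN n hn
  exact exists_regular_no_biHole hn (Nat.sub_add_cancel hk).le h
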